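/- Fix ν ∈ (0,1), Δx > 0 and an integer n ≥ 3. Then the coefficients B̄_k^n satisfy B̄_0^n > B̄_1^n > ⋯ > B̄_{n−1}^n > 0, and for every k with 0 ≤ k ≤ n−1, B̄_k^n ≥ ((k+1)^{1−ν} − k^{1−ν}) / (9·Δx^ν·Γ(2−ν)). -/

import Mathlib

open Real Finset

noncomputable section

/-- α₀ = (ν+2)/(2^ν·Γ(3−ν)). -/
def alpha0 (ν : ℝ) : ℝ := (ν + 2) / ((2 : ℝ) ^ ν * Real.Gamma (3 - ν))

/-- θ = 2ν/(2+ν). -/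
def theta (ν : ℝ) : ℝ := 2 * ν / (2 + ν)

/-- The coefficients D̄_k^(m). -/
def Dbar (ν : ℝ) (m k : ℕ) : ℝ :=
  if k = 0 then
    (1 / Real.Gamma (3 - ν)) *
      (-((2 - ν) / 2) * ((2 * m : ℝ) ^ (1 - ν) + 3 * ((2 * m : ℝ) + 2) ^ (1 - ν))
        - (2 * m : ℝ) ^ (2 - ν) + ((2 * m : ℝ) + 2) ^ (2 - ν))
  else if k % 2 = 0 then
    (1 / Real.Gamma (3 - ν)) *
      (-((2 - ν) / 2) * (((2 * m : ℝ) - 2 * (k / 2 : ℕ)) ^ (1 - ν)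
          + 6 * ((2 * m : ℝ) - 2 * (k / 2 : ℕ) + 2) ^ (1 - ν)
          + ((2 * m : ℝ) - 2 * (k / 2 : ℕ) + 4) ^ (1 - ν))
        - ((2 * m : ℝ) - 2 * (k / 2 : ℕ)) ^ (2 - ν)
        + ((2 * m : ℝ) - 2 * (k / 2 : ℕ) + 4) ^ (2 - ν))
  else
    (2 / Real.Gamma (3 - ν)) *
      ((2 - ν) * (((2 * m : ℝ) - 2 * (k / 2 : ℕ)) ^ (1 - ν)
          + ((2 * m : ℝ) - 2 * (k / 2 : ℕ) + 2) ^ (1 - ν))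
        + ((2 * m : ℝ) - 2 * (k / 2 : ℕ)) ^ (2 - ν)
        - ((2 * m : ℝ) - 2 * (k / 2 : ℕ) + 2) ^ (2 - ν))

/-- The coefficients D_k^(m); for k ≥ 3 one has D_k^(m) = D̄_{k+1}^(m). -/
def Dco (ν : ℝ) (m k : ℕ) : ℝ :=
  if k = 0 then
    (1 / Real.Gamma (3 - ν)) *
      (((2 - ν) / 2) * ((2 * m : ℝ) ^ (1 - ν) - 3 * ((2 * m : ℝ) + 1) ^ (1 - ν))
        - (2 * m : ℝ) ^ (2 - ν) + ((2 * m : ℝ) + 1) ^ (2 - ν))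
  else if k = 1 then
    (1 / Real.Gamma (3 - ν)) *
      (-((2 - ν) / 2) * (((2 * m : ℝ) - 2) ^ (1 - ν) + 3 * (2 * m : ℝ) ^ (1 - ν)
          - 4 * ((2 * m : ℝ) + 1) ^ (1 - ν))
        - ((2 * m : ℝ) - 2) ^ (2 - ν) + 3 * (2 * m : ℝ) ^ (2 - ν)
        - 2 * ((2 * m : ℝ) + 1) ^ (2 - ν))
  else if k = 2 then
    (1 / Real.Gamma (3 - ν)) *
      (((2 - ν) / 2) * (4 * ((2 * m : ℝ) - 2) ^ (1 - ν) + 3 * (2 * m : ℝ) ^ (1 - ν)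
          - ((2 * m : ℝ) + 1) ^ (1 - ν))
        + 2 * ((2 * m : ℝ) - 2) ^ (2 - ν) - 3 * (2 * m : ℝ) ^ (2 - ν)
        + ((2 * m : ℝ) + 1) ^ (2 - ν))
  else Dbar ν m (k + 1)

/-- The scheme coefficients d_k^j. -/
def dco (ν : ℝ) (j k : ℕ) : ℝ :=
  if j % 2 = 1 then -Dco ν (j / 2) k / alpha0 ν
  else -Dbar ν (j / 2 - 1) k / alpha0 ν

/-- The transformed coefficients d̄_k^j. -/
def dbarco (ν : ℝ) (j k : ℕ) : ℝ :=
  if k = j then -1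
  else if j = 3 then
    if k = 2 then dco ν 3 2 - theta ν
    else if k = 1 then theta ν * (dco ν 3 2 - theta ν) + dco ν 3 1
    else theta ν * (theta ν * (dco ν 3 2 - theta ν) + dco ν 3 1) + dco ν 3 0
  else
    theta ν ^ (j - k) + ∑ k' ∈ Finset.Icc k (j - 2), dco ν j k' * theta ν ^ (k' - k)

/-- The coefficients B̄_i^n: B̄_0^n = Δx^{−ν}α₀ and
    B̄_{n−k}^n = B̄_{n−k−1}^n − Δx^{−ν}·α₀·d̄_k^n for k = n−1,…,1. -/
def Bbar (ν Δx : ℝ) (n : ℕ) : ℕ → ℝ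
  | 0 => Δx ^ (-ν) * alpha0 ν
  | i + 1 => Bbar ν Δx n i - Δx ^ (-ν) * alpha0 ν * dbarco ν n (n - (i + 1))

/-- The complementary discrete kernels P_j^n. -/
def Pker (ν Δx : ℝ) (n : ℕ) : ℕ → ℝ
  | 0 => 1 / Bbar ν Δx n 0
  | j + 1 =>
    if n ≤ j + 3 then 0
    else (1 / Bbar ν Δx (n - (j + 1)) 0) *
      ∑ k ∈ (Finset.range (j + 1)).attach,
        (Bbar ν Δx (n - k.1) (j - k.1) - Bbar ν Δx (n - k.1) (j + 1 - k.1)) * Pker ν Δx n k.1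
  decreasing_by
    have := Finset.mem_range.mp k.2; omega

/-- D̂_0, D̂_1, D̂_2, D̃_0, D̃_1, D̃_2 : first/second-step coefficients. -/
def Dhat0 (ν : ℝ) : ℝ := (3 * ν - 4) / (2 * Real.Gamma (3 - ν))
def Dhat1 (ν : ℝ) : ℝ := 2 * (1 - ν) / Real.Gamma (3 - ν)
def Dhat2 (ν : ℝ) : ℝ := ν / (2 * Real.Gamma (3 - ν))
def Dtil0 (ν : ℝ) : ℝ := (3 * ν - 2) / ((2 : ℝ) ^ ν * Real.Gamma (3 - ν))
def Dtil1 (ν : ℝ) : ℝ := -(4 * ν) / ((2 : ℝ) ^ ν * Real.Gamma (3 - ν))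
def Dtil2 (ν : ℝ) : ℝ := (ν + 2) / ((2 : ℝ) ^ ν * Real.Gamma (3 - ν))

/-- The Caputo fractional derivative of order ν. -/
def caputo (ν : ℝ) (y : ℝ → ℝ) (x : ℝ) : ℝ :=
  (1 / Real.Gamma (1 - ν)) * ∫ s in (0:ℝ)..x, (x - s) ^ (-ν) * deriv y s

/-- The discrete Caputo derivative of a function y at the grid point x_j = jΔx. -/
def discCaputo (ν Δx : ℝ) (y : ℝ → ℝ) (j : ℕ) : ℝ :=
  if j = 1 then
    Δx ^ (-ν) * (Dhat0 ν * y 0 + Dhat1 ν * y Δx + Dhat2 ν * y (2 * Δx))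
  else if j = 2 then
    Δx ^ (-ν) * (Dtil0 ν * y 0 + Dtil1 ν * y Δx + Dtil2 ν * y (2 * Δx))
  else if j % 2 = 1 then
    Δx ^ (-ν) * ((∑ k ∈ Finset.range j, Dco ν (j / 2) k * y ((k : ℝ) * Δx))
      + alpha0 ν * y ((j : ℝ) * Δx))
  else
    Δx ^ (-ν) * ((∑ k ∈ Finset.range j, Dbar ν (j / 2 - 1) k * y ((k : ℝ) * Δx))
      + alpha0 ν * y ((j : ℝ) * Δx))

/-- Truncation error r_j(Δx). -/
def trunc (ν Δx : ℝ) (y : ℝ → ℝ) (j : ℕ) : ℝ :=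
  caputo ν y ((j : ℝ) * Δx) - discCaputo ν Δx y j

/-- The Mittag–Leffler function E_ν(z) = Σ_{k≥0} z^k/Γ(1+kν). -/
def mlE (ν z : ℝ) : ℝ := ∑' k : ℕ, z ^ k / Real.Gamma (1 + (k : ℝ) * ν)

end

theorem nonpos_of_second_deriv_nonpos {φ φ' φ'' : ℝ → ℝ} {H : ℝ} (hH : 0 ≤ H)
    (h1 : ∀ h ∈ Set.Icc 0 H, HasDerivAt φ (φ' h) h)
    (h2 : ∀ h ∈ Set.Icc 0 H, HasDerivAt φ' (φ'' h) h)
    (h0 : φ 0 = 0) (h0' : φ' 0 = 0) (hneg : ∀ h ∈ Set.Icc 0 H, φ'' h ≤ 0) : φ H ≤ 0 := by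
  have anti : ∀ {g g' : ℝ → ℝ}, (∀ h ∈ Set.Icc 0 H, HasDerivAt g (g' h) h) →
      (∀ h ∈ Set.Icc 0 H, g' h ≤ 0) → g 0 = 0 → ∀ h ∈ Set.Icc 0 H, g h ≤ 0 := by
    intro g g' hg hg' hg0 h hh
    have : AntitoneOn g (Set.Icc 0 H) := by
      refine antitoneOn_of_hasDerivWithinAt_nonpos (f' := g') (convex_Icc 0 H)
        (fun x hx => (hg x hx).continuousAt.continuousWithinAt) ?_ ?_
      · exact fun x hx => (hg x (interior_subset hx)).hasDerivWithinAt
      · exact fun x hx => hg' x (interior_subset hx)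
    simpa [hg0] using this (Set.left_mem_Icc.2 hH) hh hh.1
  exact anti h1 (anti h2 hneg h0') h0 H (Set.right_mem_Icc.2 hH)

theorem hasDerivAt_affine_rpow {t b h p q : ℝ} (hpq : q = p - 1) (hx : 0 < t + b * h) :
    HasDerivAt (fun h => (t + b * h) ^ p) (b * p * (t + b * h) ^ q) h := by
  have h1 : HasDerivAt (fun h : ℝ => t + b * h) b h := by
    simpa using ((hasDerivAt_id h).const_mul b).const_add t
  simpa [hpq] using h1.rpow_const (p := p) (Or.inl hx.ne')

theorem rpow_le_tangent {x y a : ℝ} (hx : 0 < x) (hy : 0 ≤ y) (ha : 0 ≤ a) (ha1 : a ≤ 1) :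
    y ^ a ≤ x ^ a + a * x ^ (a - 1) * (y - x) := by
  have hs : -1 ≤ y / x - 1 := by linarith [div_nonneg hy hx.le]
  have hb := rpow_one_add_le_one_add_mul_self hs ha ha1
  rw [add_sub_cancel, div_rpow hy hx.le, div_le_iff₀ (by positivity)] at hb
  rw [rpow_sub_one hx.ne']
  calc _ ≤ _ := hb
    _ = _ := by field_simp

theorem tangent_le_rpow {x y a : ℝ} (hx : 0 < x) (hy : 0 ≤ y) (ha : 1 ≤ a) :
    x ^ a + a * x ^ (a - 1) * (y - x) ≤ y ^ a := by
  have hs : -1 ≤ y / x - 1 := by linarith [div_nonneg hy hx.le]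
  have hb := one_add_mul_self_le_rpow_one_add hs ha
  rw [add_sub_cancel, div_rpow hy hx.le, le_div_iff₀ (by positivity)] at hb
  rw [rpow_sub_one hx.ne']
  calc _ = _ := by field_simp
    _ ≤ _ := hb

/-- The function `x ^ (-ν)` lies above its tangents. -/
theorem tangent_le_rpow_neg {ν x y : ℝ} (h0 : 0 < ν) (h1 : ν < 1) (hx : 0 < x) (hy : 0 < y) :
    x ^ (-ν) - ν * x ^ (-ν - 1) * (y - x) ≤ y ^ (-ν) := by
  have hb := rpow_one_add_le_one_add_mul_self (s := y / x - 1) (p := ν)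
    (by linarith [div_nonneg hy.le hx.le]) h0.le h1.le
  rw [add_sub_cancel] at hb
  have hr : 0 < y / x := by positivity
  have hp : 0 < (y / x) ^ ν := by positivity
  have hinv : 1 - ν * (y / x - 1) ≤ ((y / x) ^ ν)⁻¹ := by
    rw [← one_div, le_div_iff₀ hp]
    nlinarith [sq_nonneg (ν * (y / x - 1)), sq_nonneg ((y / x) ^ ν - 1),
      sq_nonneg (1 + ν * (y / x - 1) - (y / x) ^ ν)]
  rw [← rpow_neg hr.le, div_rpow hy.le hx.le, le_div_iff₀ (by positivity)] at hinv
  rw [rpow_sub_one hx.ne']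
  calc _ = _ := by field_simp
    _ ≤ _ := hinv

/-- A secant-type upper bound for `x ^ (-ν)` on `[x, 2 * x]`. -/
theorem rpow_neg_le_secant {ν x h : ℝ} (h0 : 0 < ν) (h1 : ν < 1) (hx : 0 < x) (hh : 0 ≤ h)
    (hhx : h ≤ x) : (x + h) ^ (-ν) ≤ x ^ (-ν) - ν * h / 2 * x ^ (-ν - 1) := by
  have hxh : 0 < x + h := by positivity
  have hb := rpow_one_add_le_one_add_mul_self (s := x / (x + h) - 1) (p := ν)
    (by linarith [div_nonneg hx.le hxh.le]) h0.le h1.le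
  rw [add_sub_cancel, div_rpow hx.le hxh.le, div_le_iff₀ (by positivity)] at hb
  have hc : 1 + ν * (x / (x + h) - 1) ≤ 1 - ν * h / (2 * x) := by
    have : x / (x + h) - 1 ≤ - (h / (2 * x)) := by
      rw [div_sub_one hxh.ne', ← neg_div, div_le_div_iff₀ hxh (by positivity)]
      nlinarith
    have := mul_le_mul_of_nonneg_left this h0.le
    calc _ ≤ 1 + ν * (-(h / (2 * x))) := by linarith
      _ = _ := by field_simp; ring
  have hd := hb.trans (mul_le_mul_of_nonneg_right hc (by positivity : 0 ≤ (x + h) ^ ν))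
  rw [rpow_sub_one hx.ne', rpow_neg hx.le, rpow_neg hxh.le]
  have hA : 0 < x ^ ν := by positivity
  have hB : 0 < (x + h) ^ ν := by positivity
  rw [inv_le_iff_one_le_mul₀ hB]
  have : ((x ^ ν)⁻¹ - ν * h / 2 * ((x ^ ν)⁻¹ / x)) * (x + h) ^ ν
    = (x ^ ν)⁻¹ * ((1 - ν * h / (2 * x)) * (x + h) ^ ν) := by field_simp
  rw [this, ← div_eq_inv_mul, one_le_div hA]
  exact hd

section Quadrature

variable {ν : ℝ}

/-- The trapezoidal rule underestimates the integral of `x ^ (1 - ν)`. -/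
theorem trapezoid_le_of_pos (h0 : 0 < ν) (h1 : ν < 1) {t H : ℝ} (ht : 0 < t) (hH : 0 ≤ H) :
    (2 - ν) * (H / 2) * (t ^ (1 - ν) + (t + H) ^ (1 - ν)) ≤ (t + H) ^ (2 - ν) - t ^ (2 - ν) := by
  have hp : ∀ h ∈ Set.Icc 0 H, 0 < t + 1 * h := fun h hh => by linarith [hh.1]
  have key := nonpos_of_second_deriv_nonpos hH
    (φ := fun h => (2 - ν) * (h / 2) * (t ^ (1 - ν) + (t + 1 * h) ^ (1 - ν))
      - ((t + 1 * h) ^ (2 - ν) - t ^ (2 - ν)))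
    (φ' := fun h => (2 - ν) / 2 * (t ^ (1 - ν) - (t + 1 * h) ^ (1 - ν))
      + (2 - ν) * (h / 2) * ((1 - ν) * (t + 1 * h) ^ (-ν)))
    (φ'' := fun h => - ((2 - ν) * (1 - ν) * ν * (h / 2) * (t + 1 * h) ^ (-ν - 1)))
    (fun h hh => ?_) (fun h hh => ?_) (by simp) (by simp) (fun h hh => ?_)
  · simp only [one_mul] at key; linarith
  · have e1 := hasDerivAt_affine_rpow (p := 1 - ν) (q := -ν) (by ring) (hp h hh)
    have e2 := hasDerivAt_affine_rpow (p := 2 - ν) (q := 1 - ν) (by ring) (hp h hh)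
    refine (((((hasDerivAt_id h).div_const 2).const_mul (2 - ν)).mul
      (e1.const_add (t ^ (1 - ν)))).sub (e2.sub_const _)).congr_deriv ?_
    simp only [id]; ring
  · have e1 := hasDerivAt_affine_rpow (p := 1 - ν) (q := -ν) (by ring) (hp h hh)
    have e2 := hasDerivAt_affine_rpow (p := -ν) (q := -ν - 1) (by ring) (hp h hh)
    refine (((e1.const_sub (t ^ (1 - ν))).const_mul ((2 - ν) / 2)).add
      ((((hasDerivAt_id h).div_const 2).const_mul (2 - ν)).mul
      (e2.const_mul (1 - ν)))).congr_deriv ?_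
    simp only [id]; ring
  · have := rpow_pos_of_pos (hp h hh) (-ν - 1)
    have h2 : 0 ≤ h := hh.1
    have a1 : 0 < 1 - ν := by linarith
    have a2 : 0 < 2 - ν := by linarith
    have : 0 ≤ (2 - ν) * (1 - ν) * ν * (h / 2) * (t + 1 * h) ^ (-ν - 1) := by positivity
    simpa using this

theorem trapezoid_le (h0 : 0 < ν) (h1 : ν < 1) {t H : ℝ} (ht : 0 ≤ t) (hH : 0 < H) :
    (2 - ν) * (H / 2) * (t ^ (1 - ν) + (t + H) ^ (1 - ν)) ≤ (t + H) ^ (2 - ν) - t ^ (2 - ν) := by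
  rcases ht.eq_or_lt with rfl | ht
  · rw [zero_rpow (by linarith), zero_rpow (by linarith), zero_add, zero_add, sub_zero,
      show 2 - ν = (1 - ν) + 1 by ring, rpow_add_one hH.ne']
    have : 0 < H ^ (1 - ν) * H := by positivity
    nlinarith
  · exact trapezoid_le_of_pos h0 h1 ht hH.le

/-- Comparison of the trapezoidal errors on `[t, t + H]` and `[t - 2 * H, t]`. -/
theorem trapezoid_error_le (h0 : 0 < ν) (h1 : ν < 1) {t H : ℝ} (hH : 0 ≤ H) (ht : 2 * H < t) :
    ((t + H) ^ (2 - ν) - t ^ (2 - ν) - (2 - ν) * (H / 2) * (t ^ (1 - ν) + (t + H) ^ (1 - ν)))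
      ≤ 2 * (t ^ (2 - ν) - (t - 2 * H) ^ (2 - ν)
        - (2 - ν) * H * ((t - 2 * H) ^ (1 - ν) + t ^ (1 - ν))) := by
  have hp : ∀ h ∈ Set.Icc 0 H, 0 < t + 1 * h := fun h hh => by linarith [hh.1]
  have hm : ∀ h ∈ Set.Icc 0 H, 0 < t + (-2) * h := fun h hh => by linarith [hh.2]
  have key := nonpos_of_second_deriv_nonpos hH
    (φ := fun h => ((t + 1 * h) ^ (2 - ν) - t ^ (2 - ν)
        - (2 - ν) * (h / 2) * (t ^ (1 - ν) + (t + 1 * h) ^ (1 - ν)))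
      - 2 * (t ^ (2 - ν) - (t + (-2) * h) ^ (2 - ν)
        - (2 - ν) * h * ((t + (-2) * h) ^ (1 - ν) + t ^ (1 - ν))))
    (φ' := fun h => (2 - ν) / 2 * ((t + 1 * h) ^ (1 - ν) - t ^ (1 - ν)
        - h * ((1 - ν) * (t + 1 * h) ^ (-ν)))
      - 2 * (2 - ν) * ((t + (-2) * h) ^ (1 - ν) - t ^ (1 - ν)
        + 2 * h * ((1 - ν) * (t + (-2) * h) ^ (-ν))))
    (φ'' := fun h => (2 - ν) * (1 - ν) * ν * h * (1 / 2 * (t + 1 * h) ^ (-ν - 1)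
      - 8 * (t + (-2) * h) ^ (-ν - 1)))
    (fun h hh => ?_) (fun h hh => ?_) (by simp) (by simp) (fun h hh => ?_)
  · simp only [one_mul, neg_mul, ← sub_eq_add_neg] at key; linarith
  · have e1 := hasDerivAt_affine_rpow (p := 1 - ν) (q := -ν) (by ring) (hp h hh)
    have e2 := hasDerivAt_affine_rpow (p := 2 - ν) (q := 1 - ν) (by ring) (hp h hh)
    have e3 := hasDerivAt_affine_rpow (p := 1 - ν) (q := -ν) (by ring) (hm h hh)
    have e4 := hasDerivAt_affine_rpow (p := 2 - ν) (q := 1 - ν) (by ring) (hm h hh)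
    refine (((e2.sub_const _).sub ((((hasDerivAt_id h).div_const 2).const_mul (2 - ν)).mul
      (e1.const_add (t ^ (1 - ν))))).sub (((e4.const_sub (t ^ (2 - ν))).sub
        (((hasDerivAt_id h).const_mul (2 - ν)).mul (e3.add_const (t ^ (1 - ν))))).const_mul
        2)).congr_deriv ?_
    simp only [id]; ring
  · have e1 := hasDerivAt_affine_rpow (p := 1 - ν) (q := -ν) (by ring) (hp h hh)
    have e2 := hasDerivAt_affine_rpow (p := -ν) (q := -ν - 1) (by ring) (hp h hh)
    have e3 := hasDerivAt_affine_rpow (p := 1 - ν) (q := -ν) (by ring) (hm h hh)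
    have e4 := hasDerivAt_affine_rpow (p := -ν) (q := -ν - 1) (by ring) (hm h hh)
    refine ((((e1.sub_const _).sub ((hasDerivAt_id h).mul (e2.const_mul (1 - ν)))).const_mul
      ((2 - ν) / 2)).sub (((e3.sub_const _).add (((hasDerivAt_id h).const_mul 2).mul
        (e4.const_mul (1 - ν)))).const_mul (2 * (2 - ν)))).congr_deriv ?_
    simp only [id]; ring
  · have hle : (t + 1 * h) ^ (-ν - 1) ≤ (t + (-2) * h) ^ (-ν - 1) :=
      rpow_le_rpow_of_nonpos (hm h hh) (by linarith [hh.1]) (by linarith)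
    have := rpow_pos_of_pos (hp h hh) (-ν - 1)
    have h2 : 0 ≤ h := hh.1
    have a1 : 0 < 1 - ν := by linarith
    have a2 : 0 < 2 - ν := by linarith
    refine mul_nonpos_of_nonneg_of_nonpos (by positivity) (by linarith)

/-- Hermite-type upper bound for the integral of `x ^ (1 - ν)` to the right of `t`. -/
theorem integral_right_le (h0 : 0 < ν) (h1 : ν < 1) {t H : ℝ} (ht : 0 < t) (hH : 0 ≤ H) :
    (t + H) ^ (2 - ν) - t ^ (2 - ν) ≤ (2 - ν) * (H ^ 2 / 4 * ((1 - ν) * t ^ (-ν))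
      + H / 4 * (3 * t ^ (1 - ν) + (t + H) ^ (1 - ν))) := by
  have hp : ∀ h ∈ Set.Icc 0 H, 0 < t + 1 * h := fun h hh => by linarith [hh.1]
  have key := nonpos_of_second_deriv_nonpos hH
    (φ := fun h => (t + 1 * h) ^ (2 - ν) - t ^ (2 - ν) -
      (2 - ν) * (h * h / 4 * ((1 - ν) * t ^ (-ν))
      + h / 4 * (3 * t ^ (1 - ν) + (t + 1 * h) ^ (1 - ν))))
    (φ' := fun h => (2 - ν) * (3 / 4 * ((t + 1 * h) ^ (1 - ν) - t ^ (1 - ν))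
      - h / 2 * ((1 - ν) * t ^ (-ν)) - h / 4 * ((1 - ν) * (t + 1 * h) ^ (-ν))))
    (φ'' := fun h => (2 - ν) * (1 - ν) * (1 / 2 * ((t + 1 * h) ^ (-ν) - t ^ (-ν))
      + ν * h / 4 * (t + 1 * h) ^ (-ν - 1)))
    (fun h hh => ?_) (fun h hh => ?_) (by simp) (by simp) (fun h hh => ?_)
  · simp only [one_mul] at key; linarith
  · have e1 := hasDerivAt_affine_rpow (p := 1 - ν) (q := -ν) (by ring) (hp h hh)
    have e2 := hasDerivAt_affine_rpow (p := 2 - ν) (q := 1 - ν) (by ring) (hp h hh)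
    refine ((e2.sub_const _).sub ((((((hasDerivAt_id h).mul (hasDerivAt_id h)).div_const
      4).mul_const _).add (((hasDerivAt_id h).div_const 4).mul
      (e1.const_add (3 * t ^ (1 - ν))))).const_mul (2 - ν))).congr_deriv ?_
    simp only [id]; ring
  · have e1 := hasDerivAt_affine_rpow (p := 1 - ν) (q := -ν) (by ring) (hp h hh)
    have e2 := hasDerivAt_affine_rpow (p := -ν) (q := -ν - 1) (by ring) (hp h hh)
    refine (((((e1.sub_const _).const_mul (3 / 4)).sub
      (((hasDerivAt_id h).div_const 2).mul_const _)).sub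
      (((hasDerivAt_id h).div_const 4).mul (e2.const_mul (1 - ν)))).const_mul
      (2 - ν)).congr_deriv ?_
    simp only [id]; ring
  · have htan := tangent_le_rpow_neg h0 h1 (hp h hh) ht
    have := rpow_pos_of_pos (hp h hh) (-ν - 1)
    have h2 : 0 ≤ h := hh.1
    have a1 : 0 < 1 - ν := by linarith
    have a2 : 0 < 2 - ν := by linarith
    have : 0 ≤ ν * h * (t + 1 * h) ^ (-ν - 1) := by positivity
    refine mul_nonpos_of_nonneg_of_nonpos (by positivity) (by linarith)

/-- Hermite-type upper bound for the integral of `x ^ (1 - ν)` to the left of `t`. -/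
theorem integral_left_le (h0 : 0 < ν) (h1 : ν < 1) {t H : ℝ} (ht : 0 < t) (hH : 0 ≤ H)
    (hHt : 2 * H ≤ t) :
    t ^ (2 - ν) - (t - H) ^ (2 - ν) ≤ (2 - ν) * (- (H ^ 2 / 4 * ((1 - ν) * t ^ (-ν)))
      + H / 4 * (3 * t ^ (1 - ν) + (t - H) ^ (1 - ν))) := by
  have hp : ∀ h ∈ Set.Icc 0 H, 0 < t + (-1) * h := fun h hh => by linarith [hh.1, hh.2]
  have key := nonpos_of_second_deriv_nonpos hH
    (φ := fun h => t ^ (2 - ν) - (t + (-1) * h) ^ (2 - ν) -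
      (2 - ν) * (- (h * h / 4 * ((1 - ν) * t ^ (-ν)))
      + h / 4 * (3 * t ^ (1 - ν) + (t + (-1) * h) ^ (1 - ν))))
    (φ' := fun h => (2 - ν) * (3 / 4 * ((t + (-1) * h) ^ (1 - ν) - t ^ (1 - ν))
      + h / 2 * ((1 - ν) * t ^ (-ν)) + h / 4 * ((1 - ν) * (t + (-1) * h) ^ (-ν))))
    (φ'' := fun h => (2 - ν) * (1 - ν) * (1 / 2 * (t ^ (-ν) - (t + (-1) * h) ^ (-ν))
      + ν * h / 4 * (t + (-1) * h) ^ (-ν - 1)))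
    (fun h hh => ?_) (fun h hh => ?_) (by simp) (by simp) (fun h hh => ?_)
  · simp only [one_mul, neg_mul, ← sub_eq_add_neg] at key; linarith
  · have e1 := hasDerivAt_affine_rpow (p := 1 - ν) (q := -ν) (by ring) (hp h hh)
    have e2 := hasDerivAt_affine_rpow (p := 2 - ν) (q := 1 - ν) (by ring) (hp h hh)
    refine ((e2.const_sub _).sub (((((((hasDerivAt_id h).mul (hasDerivAt_id h)).div_const
      4).mul_const _).neg).add (((hasDerivAt_id h).div_const 4).mul
      (e1.const_add (3 * t ^ (1 - ν))))).const_mul (2 - ν))).congr_deriv ?_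
    simp only [id]; ring
  · have e1 := hasDerivAt_affine_rpow (p := 1 - ν) (q := -ν) (by ring) (hp h hh)
    have e2 := hasDerivAt_affine_rpow (p := -ν) (q := -ν - 1) (by ring) (hp h hh)
    refine (((((e1.sub_const _).const_mul (3 / 4)).add
      (((hasDerivAt_id h).div_const 2).mul_const _)).add
      (((hasDerivAt_id h).div_const 4).mul (e2.const_mul (1 - ν)))).const_mul
      (2 - ν)).congr_deriv ?_
    simp only [id]; ring
  · have hsec := rpow_neg_le_secant h0 h1 (hp h hh) hh.1 (by linarith [hh.2])
    rw [show t + (-1) * h + h = t by ring] at hsec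
    have a1 : 0 < 1 - ν := by linarith
    have a2 : 0 < 2 - ν := by linarith
    refine mul_nonpos_of_nonneg_of_nonpos (by positivity) (by linarith)

/-- Lower bound for the integral of `x ^ (1 - ν)` on `[t, t + H]`. -/
theorem le_integral_right (h0 : 0 < ν) (h1 : ν < 1) {t H : ℝ} (ht : 0 < t) (hH : 0 ≤ H) :
    (2 - ν) * (H * (t + H) ^ (1 - ν) - H ^ 2 / 2 * ((1 - ν) * t ^ (-ν)))
      ≤ (t + H) ^ (2 - ν) - t ^ (2 - ν) := by
  have hp : ∀ h ∈ Set.Icc 0 H, 0 < t + 1 * h := fun h hh => by linarith [hh.1]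
  have hanti : AntitoneOn (fun h => (2 - ν) * (h * (t + 1 * h) ^ (1 - ν)
      - h * h / 2 * ((1 - ν) * t ^ (-ν))) - ((t + 1 * h) ^ (2 - ν) - t ^ (2 - ν)))
      (Set.Icc 0 H) := by
    have hd : ∀ h ∈ Set.Icc 0 H, HasDerivAt (fun h => (2 - ν) * (h * (t + 1 * h) ^ (1 - ν)
        - h * h / 2 * ((1 - ν) * t ^ (-ν))) - ((t + 1 * h) ^ (2 - ν) - t ^ (2 - ν)))
        ((2 - ν) * (1 - ν) * h * ((t + 1 * h) ^ (-ν) - t ^ (-ν))) h := by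
      intro h hh
      have e1 := hasDerivAt_affine_rpow (p := 1 - ν) (q := -ν) (by ring) (hp h hh)
      have e2 := hasDerivAt_affine_rpow (p := 2 - ν) (q := 1 - ν) (by ring) (hp h hh)
      refine (((((hasDerivAt_id h).mul e1).sub ((((hasDerivAt_id h).mul
        (hasDerivAt_id h)).div_const 2).mul_const _)).const_mul (2 - ν)).sub
        (e2.sub_const _)).congr_deriv ?_
      simp only [id]; ring
    refine antitoneOn_of_hasDerivWithinAt_nonpos (convex_Icc 0 H)
      (fun x hx => (hd x hx).continuousAt.continuousWithinAt)
      (fun x hx => (hd x (interior_subset hx)).hasDerivWithinAt) (fun x hx => ?_)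
    have hx := interior_subset hx
    have : (t + 1 * x) ^ (-ν) ≤ t ^ (-ν) :=
      rpow_le_rpow_of_nonpos ht (by linarith [hx.1]) (by linarith)
    have h2 : 0 ≤ x := hx.1
    have a1 : 0 < 1 - ν := by linarith
    have a2 : 0 < 2 - ν := by linarith
    exact mul_nonpos_of_nonneg_of_nonpos (by positivity) (by linarith)
  have := hanti (Set.left_mem_Icc.2 hH) (Set.right_mem_Icc.2 hH) hH
  simp only [one_mul, zero_mul, mul_zero, add_zero, sub_self, zero_div] at this
  linarith

end Quadrature

section Coefficients

variable {ν : ℝ}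

/-- The coefficient of the midpoint of a pair of grid cells at distance `x` from the endpoint. -/
noncomputable def midWeight (ν x : ℝ) : ℝ :=
  (2 / Real.Gamma (3 - ν)) * ((2 - ν) * (x ^ (1 - ν) + (x + 2) ^ (1 - ν))
    + x ^ (2 - ν) - (x + 2) ^ (2 - ν))

/-- The coefficient of the common node of two adjacent pairs of grid cells, the nearer of which
is at distance `x` from the endpoint. -/
noncomputable def nodeWeight (ν x : ℝ) : ℝ :=
  (1 / Real.Gamma (3 - ν)) * (-((2 - ν) / 2) * (x ^ (1 - ν) + 6 * (x + 2) ^ (1 - ν)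
    + (x + 4) ^ (1 - ν)) - x ^ (2 - ν) + (x + 4) ^ (2 - ν))

theorem gamma_three_sub_pos (h1 : ν < 1) : 0 < Real.Gamma (3 - ν) :=
  Real.Gamma_pos_of_pos (by linarith)

theorem alpha0_pos (h0 : 0 < ν) (h1 : ν < 1) : 0 < alpha0 ν := by
  have := gamma_three_sub_pos h1
  unfold alpha0; positivity

theorem theta_pos (h0 : 0 < ν) : 0 < theta ν := by
  unfold theta; positivity

theorem theta_lt_one (h0 : 0 < ν) (h1 : ν < 1) : theta ν < 1 := by
  unfold theta; rw [div_lt_one (by linarith)]; linarith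

theorem midWeight_nonpos (h0 : 0 < ν) (h1 : ν < 1) {x : ℝ} (hx : 0 ≤ x) : midWeight ν x ≤ 0 := by
  have := gamma_three_sub_pos h1
  have := trapezoid_le h0 h1 hx (H := 2) (by norm_num)
  exact mul_nonpos_of_nonneg_of_nonpos (by positivity) (by linarith)

theorem nodeWeight_nonpos (h0 : 0 < ν) (h1 : ν < 1) {x : ℝ} (hx : 2 ≤ x) :
    nodeWeight ν x ≤ 0 := by
  have := gamma_three_sub_pos h1
  have hr := integral_right_le h0 h1 (t := x + 2) (H := 2) (by linarith) (by norm_num)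
  have hl := integral_left_le h0 h1 (t := x + 2) (H := 2) (by linarith) (by norm_num)
    (by linarith)
  rw [show x + 2 - 2 = x by ring] at hl
  rw [show x + 2 + 2 = x + 4 by ring] at hr
  exact mul_nonpos_of_nonneg_of_nonpos (by positivity) (by linarith)

theorem Dbar_odd (p q : ℕ) : Dbar ν (p + q) (2 * p + 1) = midWeight ν (2 * q) := by
  have h1 : (2 * p + 1) % 2 ≠ 0 := by omega
  have h2 : (2 * p + 1) / 2 = p := by omega
  have h3 : (2 * ((p + q : ℕ) : ℝ) - 2 * (p : ℝ)) = 2 * q := by push_cast; ring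
  rw [Dbar, if_neg (by omega), if_neg h1, h2, h3, midWeight]

theorem Dbar_even {p : ℕ} (hp : 1 ≤ p) (q : ℕ) :
    Dbar ν (p + q) (2 * p) = nodeWeight ν (2 * q) := by
  have h1 : (2 * p) % 2 = 0 := by omega
  have h2 : (2 * p) / 2 = p := by omega
  have h3 : (2 * ((p + q : ℕ) : ℝ) - 2 * (p : ℝ)) = 2 * q := by push_cast; ring
  rw [Dbar, if_neg (by omega), if_pos h1, h2, h3, nodeWeight]

theorem Dco_of_three_le {m k : ℕ} (hk : 3 ≤ k) : Dco ν m k = Dbar ν m (k + 1) := by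
  rw [Dco, if_neg (by omega), if_neg (by omega), if_neg (by omega)]

theorem dco_odd (m k : ℕ) : dco ν (2 * m + 1) k = -Dco ν m k / alpha0 ν := by
  rw [dco, if_pos (by omega), show (2 * m + 1) / 2 = m by omega]

theorem dco_even (m k : ℕ) : dco ν (2 * m + 2) k = -Dbar ν m k / alpha0 ν := by
  rw [dco, if_neg (by omega), show (2 * m + 2) / 2 - 1 = m by omega]

/-- Away from the left end, the coefficients depend only on the distance to the right end:
coefficients at odd distance. -/
theorem dco_mid {n k q : ℕ} (hk : 1 ≤ k) (hn : n = k + 2 * q + 1) (hodd : n % 2 = 1 → 3 ≤ k) :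
    dco ν n k = -midWeight ν (2 * q) / alpha0 ν := by
  rcases Nat.even_or_odd' n with ⟨r, hr | hr⟩
  · obtain ⟨p, rfl⟩ : ∃ p, k = 2 * p + 1 := ⟨k / 2, by omega⟩
    rw [show n = 2 * (p + q) + 2 by omega, dco_even, Dbar_odd]
  · obtain ⟨p, hp⟩ : ∃ p, k + 1 = 2 * p + 1 := ⟨k / 2, by omega⟩
    rw [show n = 2 * (p + q) + 1 by omega, dco_odd, Dco_of_three_le (hodd (by omega)), hp,
      Dbar_odd]

/-- Away from the left end, the coefficients depend only on the distance to the right end: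
coefficients at even distance. -/
theorem dco_node {n k q : ℕ} (hk : 1 ≤ k) (hn : n = k + 2 * q + 2) (hodd : n % 2 = 1 → 3 ≤ k) :
    dco ν n k = -nodeWeight ν (2 * q) / alpha0 ν := by
  rcases Nat.even_or_odd' n with ⟨r, hr | hr⟩
  · obtain ⟨p, rfl⟩ : ∃ p, k = 2 * p := ⟨k / 2, by omega⟩
    rw [show n = 2 * (p + q) + 2 by omega, dco_even, Dbar_even (by omega)]
  · obtain ⟨p, hp⟩ : ∃ p, k + 1 = 2 * p := ⟨(k + 1) / 2, by omega⟩
    rw [show n = 2 * (p + q) + 1 by omega, dco_odd, Dco_of_three_le (hodd (by omega)), hp,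
      Dbar_even (by omega)]

theorem Dco_one_nonpos (h0 : 0 < ν) (h1 : ν < 1) {m : ℕ} (hm : 2 ≤ m) : Dco ν m 1 ≤ 0 := by
  have hG := gamma_three_sub_pos h1
  have hm' : (2 : ℝ) ≤ m := by exact_mod_cast hm
  have hl := integral_left_le h0 h1 (t := 2 * m) (H := 2) (by linarith) (by norm_num)
    (by linarith)
  have hr := le_integral_right h0 h1 (t := 2 * m) (H := 1) (by linarith) (by norm_num)
  rw [Dco, if_neg (by omega), if_pos rfl]
  exact mul_nonpos_of_nonneg_of_nonpos (by positivity) (by linarith)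

theorem Dco_two_nonpos (h0 : 0 < ν) (h1 : ν < 1) {m : ℕ} (hm : 2 ≤ m) : Dco ν m 2 ≤ 0 := by
  have hG := gamma_three_sub_pos h1
  have hm' : (2 : ℝ) ≤ m := by exact_mod_cast hm
  have := trapezoid_error_le h0 h1 (t := 2 * m) (H := 1) (by norm_num) (by linarith)
  rw [mul_one] at this
  rw [Dco, if_neg (by omega), if_neg (by omega), if_pos rfl]
  exact mul_nonpos_of_nonneg_of_nonpos (by positivity) (by linarith)

theorem dco_nonneg (h0 : 0 < ν) (h1 : ν < 1) {n k : ℕ} (hk : 1 ≤ k) (hkn : k + 3 ≤ n) :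
    0 ≤ dco ν n k := by
  have ha := alpha0_pos h0 h1
  by_cases hodd : n % 2 = 1 → 3 ≤ k
  · obtain ⟨q, hq | hq⟩ : ∃ q, n = k + 2 * q + 1 ∨ n = k + 2 * q + 2 :=
      ⟨(n - k - 1) / 2, by omega⟩
    · rw [dco_mid hk hq hodd]
      exact div_nonneg (neg_nonneg.2 (midWeight_nonpos h0 h1 (by positivity))) ha.le
    · rw [dco_node hk hq hodd]
      have : (1 : ℝ) ≤ q := by exact_mod_cast (by omega : 1 ≤ q)
      exact div_nonneg (neg_nonneg.2 (nodeWeight_nonpos h0 h1 (by linarith))) ha.le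
  · obtain ⟨m, rfl⟩ : ∃ m, n = 2 * m + 1 := ⟨n / 2, by omega⟩
    rw [dco_odd]
    obtain rfl | rfl : k = 1 ∨ k = 2 := by omega
    · exact div_nonneg (neg_nonneg.2 (Dco_one_nonpos h0 h1 (by omega))) ha.le
    · exact div_nonneg (neg_nonneg.2 (Dco_two_nonpos h0 h1 (by omega))) ha.le

theorem midWeight_zero (h0 : 0 < ν) (h1 : ν < 1) :
    midWeight ν 0 = -(2 * theta ν * alpha0 ν) := by
  have hG := gamma_three_sub_pos h1
  have h2 : (0 : ℝ) < 2 ^ ν := by positivity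
  simp only [midWeight, zero_add]
  rw [zero_rpow (by linarith), zero_rpow (by linarith), zero_add,
    rpow_sub two_pos, rpow_sub two_pos, theta, alpha0]
  norm_num
  field_simp
  ring

theorem two_rpow_gt (h0 : 0 < ν) (h1 : ν < 1) : (2 + ν) * (6 + ν) < 2 ^ ν * (12 - ν ^ 2) := by
  have hlog : 0.693 * ν ≤ Real.log 2 * ν :=
    mul_le_mul_of_nonneg_right (by linarith [Real.log_two_gt_d9]) h0.le
  have hexp : 1 + 0.693 * ν + (0.693 * ν) ^ 2 / 2 ≤ (2 : ℝ) ^ ν := by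
    rw [rpow_def_of_pos two_pos]
    exact (quadratic_le_exp_of_nonneg (by positivity)).trans (exp_le_exp.2 hlog)
  have hq : 0 < 12 - ν ^ 2 := by nlinarith
  refine lt_of_lt_of_le ?_ (mul_le_mul_of_nonneg_right hexp hq.le)
  have a2 : ν ^ 3 ≤ ν ^ 2 := by nlinarith [sq_nonneg ν]
  have a3 : ν ^ 4 ≤ ν ^ 2 := by nlinarith [sq_nonneg ν, sq_nonneg (ν ^ 2)]
  have a4 : ν ^ 2 ≤ ν := by nlinarith
  nlinarith

theorem nodeWeight_zero_lt (h0 : 0 < ν) (h1 : ν < 1) :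
    0 < -nodeWeight ν (2 * (0 : ℕ)) / alpha0 ν + theta ν * theta ν := by
  have hG := gamma_three_sub_pos h1
  have h2 : (0 : ℝ) < 2 ^ ν := by positivity
  have h4 : (4 : ℝ) ^ ν = 2 ^ ν * 2 ^ ν := by
    rw [← mul_rpow two_pos.le two_pos.le]; norm_num
  have hν : 0 < ν + 2 := by linarith
  have hν' : 0 < 2 + ν := by linarith
  have key : -nodeWeight ν (2 * (0 : ℕ)) / alpha0 ν + theta ν * theta ν
      = 2 * (2 ^ ν * (12 - ν ^ 2) - (2 + ν) * (6 + ν)) / (2 ^ ν * (2 + ν) ^ 2) := by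
    simp only [nodeWeight, Nat.cast_zero, mul_zero, zero_add]
    rw [zero_rpow (by linarith), zero_rpow (by linarith), zero_add, rpow_sub two_pos, rpow_sub (by norm_num), rpow_sub (by norm_num), theta,
      alpha0, h4]
    norm_num
    field_simp
    ring
  rw [key]
  have := two_rpow_gt h0 h1
  exact div_pos (by linarith) (by positivity)

theorem dco_three_two (h0 : 0 < ν) (h1 : ν < 1) : dco ν 3 2 - theta ν
    = (3 ^ ν * (6 + ν) - 2 ^ ν * (6 + 3 / 2 * ν)) / ((ν + 2) * 3 ^ ν) := by
  have hG := gamma_three_sub_pos h1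
  have h2 : (0 : ℝ) < 2 ^ ν := by positivity
  have h3 : (0 : ℝ) < 3 ^ ν := by positivity
  have hν : 0 < ν + 2 := by linarith
  have hν' : 0 < 2 + ν := by linarith
  have hz1 : (0 : ℝ) ^ (1 - ν) = 0 := zero_rpow (by linarith)
  have hz2 : (0 : ℝ) ^ (2 - ν) = 0 := zero_rpow (by linarith)
  rw [show (3 : ℕ) = 2 * 1 + 1 from rfl, dco_odd, Dco, if_neg (by omega), if_neg (by omega),
    if_pos rfl, Nat.cast_one, mul_one, sub_self, hz1, hz2, show (2 : ℝ) + 1 = 3 by norm_num,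
    rpow_sub two_pos, rpow_sub two_pos, rpow_sub three_pos, rpow_sub three_pos, theta, alpha0]
  norm_num
  field_simp
  ring

theorem dco_three_one (h0 : 0 < ν) (h1 : ν < 1) : dco ν 3 1
    = (2 ^ ν * (6 + 6 * ν) - 3 ^ ν * (6 + 3 * ν)) / ((ν + 2) * 3 ^ ν) := by
  have hG := gamma_three_sub_pos h1
  have h2 : (0 : ℝ) < 2 ^ ν := by positivity
  have h3 : (0 : ℝ) < 3 ^ ν := by positivity
  have hν : 0 < ν + 2 := by linarith
  have hz1 : (0 : ℝ) ^ (1 - ν) = 0 := zero_rpow (by linarith)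
  have hz2 : (0 : ℝ) ^ (2 - ν) = 0 := zero_rpow (by linarith)
  rw [show (3 : ℕ) = 2 * 1 + 1 from rfl, dco_odd, Dco, if_neg (by omega), if_pos rfl,
    Nat.cast_one, mul_one, sub_self, hz1, hz2, show (2 : ℝ) + 1 = 3 by norm_num,
    rpow_sub two_pos, rpow_sub two_pos, rpow_sub three_pos, rpow_sub three_pos, alpha0]
  norm_num
  field_simp
  ring

theorem three_rpow_eq : (3 : ℝ) ^ ν = 2 ^ ν * (1 + 1 / 2) ^ ν := by
  rw [← mul_rpow two_pos.le (by norm_num)]; norm_num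

theorem three_halves_rpow_le (h0 : 0 < ν) (h1 : ν < 1) :
    (1 + 1 / 2 : ℝ) ^ ν ≤ 1 + ν * (1 / 2) :=
  rpow_one_add_le_one_add_mul_self (by norm_num) h0.le h1.le

theorem le_three_halves_rpow (h0 : 0 < ν) : 1 + ν / 3 ≤ (1 + 1 / 2 : ℝ) ^ ν := by
  rw [rpow_def_of_pos (by norm_num)]
  have hl : (1 / 3 : ℝ) ≤ Real.log (1 + 1 / 2) := by
    have := Real.one_sub_inv_le_log_of_pos (x := 1 + 1 / 2) (by norm_num)
    norm_num at this ⊢; linarith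
  have := add_one_le_exp (Real.log (1 + 1 / 2) * ν)
  nlinarith

theorem dbarco_three_two_pos (h0 : 0 < ν) (h1 : ν < 1) : 0 < dco ν 3 2 - theta ν := by
  have h2 : (0 : ℝ) < 2 ^ ν := by positivity
  rw [dco_three_two h0 h1]
  refine div_pos ?_ (by positivity)
  have := le_three_halves_rpow h0
  have : 0 < (1 + 1 / 2 : ℝ) ^ ν * (6 + ν) - (6 + 3 / 2 * ν) := by nlinarith
  rw [three_rpow_eq]
  nlinarith [mul_pos h2 this]

theorem dbarco_three_one_pos (h0 : 0 < ν) (h1 : ν < 1) :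
    0 < dco ν 3 1 + theta ν * (dco ν 3 2 - theta ν) := by
  have h2 : (0 : ℝ) < 2 ^ ν := by positivity
  have h3 : (0 : ℝ) < 3 ^ ν := by positivity
  have hν : 0 < ν + 2 := by linarith
  have hν' : 0 < 2 + ν := by linarith
  have key : dco ν 3 1 + theta ν * (dco ν 3 2 - theta ν)
      = (2 ^ ν * (12 + 6 * ν + 3 * ν ^ 2) - 3 ^ ν * (12 + ν ^ 2)) / ((ν + 2) ^ 2 * 3 ^ ν) := by
    rw [dco_three_two h0 h1, dco_three_one h0 h1, theta]
    field_simp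
    ring
  rw [key]
  refine div_pos ?_ (by positivity)
  have := three_halves_rpow_le h0 h1
  have : 0 < (12 + 6 * ν + 3 * ν ^ 2) - (1 + 1 / 2 : ℝ) ^ ν * (12 + ν ^ 2) := by
    have := mul_le_mul_of_nonneg_right this (by positivity : 0 ≤ 12 + ν ^ 2)
    nlinarith [mul_pos (mul_pos h0 h0) (sub_pos.2 h1), mul_pos h0 h0]
  rw [three_rpow_eq]
  nlinarith [mul_pos h2 this]

theorem dbarco_pred (h0 : 0 < ν) (h1 : ν < 1) {n : ℕ} (hn : 3 ≤ n) :
    dbarco ν n (n - 1) = dco ν n (n - 1) - theta ν := by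
  rcases hn.eq_or_lt with rfl | hn
  · simp [dbarco]
  · have hm : dco ν n (n - 1) = 2 * theta ν := by
      rw [dco_mid (q := 0) (by omega) (by omega) (by omega), Nat.cast_zero, mul_zero,
        midWeight_zero h0 h1, neg_neg, mul_div_assoc, div_self (alpha0_pos h0 h1).ne', mul_one]
    rw [hm, dbarco, if_neg (by omega), if_neg (by omega), Icc_eq_empty (by omega),
      show n - (n - 1) = 1 by omega]
    simp
    ring

theorem dbarco_rec {n k : ℕ} (hn : 3 ≤ n) (hk : 1 ≤ k) (hkn : k + 2 ≤ n) :
    dbarco ν n k = dco ν n k + theta ν * dbarco ν n (k + 1) := by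
  rcases hn.eq_or_lt with rfl | hn
  · obtain rfl : k = 1 := by omega
    simp [dbarco]
    ring
  · rw [dbarco, if_neg (by omega), if_neg (by omega), dbarco, if_neg (by omega),
      if_neg (by omega), ← Finset.insert_Icc_add_one_left_eq_Icc (by omega : k ≤ n - 2),
      sum_insert (by simp), mul_add, mul_sum, Nat.sub_self, pow_zero, mul_one, ← pow_succ',
      show n - (k + 1) + 1 = n - k by omega]
    have : ∀ i ∈ Icc (k + 1) (n - 2), dco ν n i * theta ν ^ (i - k)
        = theta ν * (dco ν n i * theta ν ^ (i - (k + 1))) := by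
      intro i hi
      rw [show i - k = i - (k + 1) + 1 by have := (mem_Icc.1 hi).1; omega, pow_succ]
      ring
    rw [sum_congr rfl this]
    ring

theorem dbarco_pred_pos (h0 : 0 < ν) (h1 : ν < 1) {n : ℕ} (hn : 3 ≤ n) :
    0 < dbarco ν n (n - 1) := by
  rcases hn.eq_or_lt with rfl | hn
  · rw [dbarco_pred h0 h1 le_rfl]; exact dbarco_three_two_pos h0 h1
  · rw [dbarco, if_neg (by omega), if_neg (by omega), Icc_eq_empty (by omega), sum_empty, add_zero]
    exact pow_pos (theta_pos h0) _

theorem dbarco_pred_pred_pos (h0 : 0 < ν) (h1 : ν < 1) {n : ℕ} (hn : 3 ≤ n) :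
    0 < dbarco ν n (n - 2) := by
  rw [dbarco_rec hn (by omega) (by omega), show n - 2 + 1 = n - 1 by omega]
  rcases hn.eq_or_lt with rfl | hn
  · rw [dbarco_pred h0 h1 le_rfl]; exact dbarco_three_one_pos h0 h1
  · have : dbarco ν n (n - 1) = theta ν := by
      rw [dbarco, if_neg (by omega), if_neg (by omega), Icc_eq_empty (by omega), sum_empty,
        add_zero, show n - (n - 1) = 1 by omega, pow_one]
    rw [this, dco_node (q := 0) (by omega) (by omega) (by omega)]
    exact nodeWeight_zero_lt h0 h1

theorem dbarco_pos (h0 : 0 < ν) (h1 : ν < 1) {n k : ℕ} (hn : 3 ≤ n) (hk : 1 ≤ k)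
    (hkn : k + 1 ≤ n) : 0 < dbarco ν n k := by
  by_cases hlast : n ≤ k + 2
  · obtain rfl | rfl : k = n - 1 ∨ k = n - 2 := by omega
    · exact dbarco_pred_pos h0 h1 hn
    · exact dbarco_pred_pred_pos h0 h1 hn
  · rw [dbarco_rec hn hk (by omega)]
    exact add_pos_of_nonneg_of_pos (dco_nonneg h0 h1 hk (by omega))
      (mul_pos (theta_pos h0) (dbarco_pos h0 h1 hn (by omega) (by omega)))
  termination_by n - k

end Coefficients

section Kernel

variable {ν Δx : ℝ} {n : ℕ}

theorem Bbar_succ_lt (h0 : 0 < ν) (h1 : ν < 1) (hΔx : 0 < Δx) (hn : 3 ≤ n) {i : ℕ}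
    (hi : i + 1 ≤ n - 1) : Bbar ν Δx n (i + 1) < Bbar ν Δx n i := by
  have := mul_pos (mul_pos (rpow_pos_of_pos hΔx (-ν)) (alpha0_pos h0 h1))
    (dbarco_pos h0 h1 hn (k := n - (i + 1)) (by omega) (by omega))
  rw [Bbar]
  linarith

/-- The coefficients of the scheme written in terms of the backward differences of the data. -/
noncomputable def diffCoeff (ν Δx : ℝ) (n : ℕ) : ℕ → ℝ
  | 0 => Bbar ν Δx n 0
  | i + 1 => Bbar ν Δx n (i + 1) - theta ν * Bbar ν Δx n i

theorem diffCoeff_succ (h0 : 0 < ν) (h1 : ν < 1) (hn : 3 ≤ n) {i : ℕ} (hi : i + 1 ≤ n - 1) :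
    diffCoeff ν Δx n (i + 1)
      = diffCoeff ν Δx n i - Δx ^ (-ν) * alpha0 ν * dco ν n (n - (i + 1)) := by
  cases i with
  | zero =>
    simp only [diffCoeff, Bbar, zero_add]
    rw [dbarco_pred h0 h1 hn]
    ring
  | succ i =>
    simp only [diffCoeff, Bbar]
    rw [dbarco_rec hn (k := n - (i + 1 + 1)) (by omega) (by omega),
      show n - (i + 1 + 1) + 1 = n - (i + 1) by omega]
    ring

/-- The difference coefficient of the right cell of a pair of grid cells at distance `x` from the
endpoint. -/
noncomputable def rightWeight (ν x : ℝ) : ℝ :=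
  (1 / Real.Gamma (3 - ν)) * ((x + 2) ^ (2 - ν) - x ^ (2 - ν)
    - (2 - ν) / 2 * ((x + 2) ^ (1 - ν) + 3 * x ^ (1 - ν)))

theorem rightWeight_add_two (x : ℝ) :
    rightWeight ν (x + 2) = rightWeight ν x + midWeight ν x + nodeWeight ν x := by
  simp only [rightWeight, midWeight, nodeWeight, show x + 2 + 2 = x + 4 by ring]
  ring

theorem rightWeight_zero (h1 : ν < 1) : rightWeight ν 0 = alpha0 ν := by
  have hG := gamma_three_sub_pos h1
  have h2 : (0 : ℝ) < 2 ^ ν := by positivity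
  rw [rightWeight, zero_rpow (by linarith), zero_rpow (by linarith), zero_add,
    rpow_sub two_pos, rpow_sub two_pos, alpha0]
  norm_num
  field_simp
  ring

theorem diffCoeff_even (h0 : 0 < ν) (h1 : ν < 1) (hn : 3 ≤ n) {q : ℕ} (hq : 2 * q + 1 ≤ n)
    (hodd : n % 2 = 1 → 3 ≤ n - 2 * q) :
    diffCoeff ν Δx n (2 * q) = Δx ^ (-ν) * rightWeight ν (2 * q) := by
  have ha := (alpha0_pos h0 h1).ne'
  induction q with
  | zero => simp [diffCoeff, Bbar, rightWeight_zero h1]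
  | succ q ih =>
    rw [show 2 * (q + 1) = 2 * q + 1 + 1 by ring, diffCoeff_succ h0 h1 hn (by omega),
      diffCoeff_succ h0 h1 hn (by omega), ih (by omega) (by omega),
      dco_mid (q := q) (by omega) (by omega) (by omega),
      dco_node (q := q) (by omega) (by omega) (by omega),
      show (2 * ((q + 1 : ℕ) : ℝ)) = 2 * q + 2 by push_cast; ring, rightWeight_add_two]
    field_simp
    ring

theorem diffCoeff_last (h0 : 0 < ν) (h1 : ν < 1) {m : ℕ} (hm : 1 ≤ m) :
    diffCoeff ν Δx (2 * m + 1) (2 * m) = Δx ^ (-ν) * ((1 / Real.Gamma (3 - ν)) *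
      ((2 * m : ℝ) ^ (2 - ν) - (2 * m + 1 : ℝ) ^ (2 - ν)
        + (2 - ν) / 2 * (3 * (2 * m + 1 : ℝ) ^ (1 - ν) - (2 * m : ℝ) ^ (1 - ν)))) := by
  have ha := (alpha0_pos h0 h1).ne'
  obtain ⟨q, rfl⟩ : ∃ q, m = q + 1 := ⟨m - 1, by omega⟩
  have hstep : diffCoeff ν Δx (2 * (q + 1) + 1) (2 * (q + 1))
      = Δx ^ (-ν) * (rightWeight ν (2 * q) + Dco ν (q + 1) 2 + Dco ν (q + 1) 1) := by
    nth_rw 2 [show 2 * (q + 1) = 2 * q + 1 + 1 by ring]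
    rw [diffCoeff_succ h0 h1 (by omega) (by omega), diffCoeff_succ h0 h1 (by omega) (by omega),
      diffCoeff_even h0 h1 (by omega) (by omega) (by omega),
      show 2 * (q + 1) + 1 - (2 * q + 1 + 1) = 1 by omega,
      show 2 * (q + 1) + 1 - (2 * q + 1) = 2 by omega, dco_odd, dco_odd]
    field_simp
    ring
  rw [hstep, Dco, if_neg (by omega), if_neg (by omega), if_pos rfl, Dco, if_neg (by omega),
    if_pos rfl, rightWeight, show (2 * ((q + 1 : ℕ) : ℝ)) = 2 * q + 2 by push_cast; ring,
    show (2 * (q : ℝ) + 2 - 2) = 2 * q by ring]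
  ring

/-- The lower bound of the kernel: the coefficients of the piecewise linear scheme, up to the
factor `1 / 9`. -/
noncomputable def lowerKernel (ν Δx : ℝ) (k : ℕ) : ℝ :=
  (((k : ℝ) + 1) ^ (1 - ν) - (k : ℝ) ^ (1 - ν)) / (9 * Δx ^ ν * Real.Gamma (2 - ν))

theorem gamma_three_sub (h1 : ν < 1) : Real.Gamma (3 - ν) = (2 - ν) * Real.Gamma (2 - ν) := by
  rw [← Real.Gamma_add_one (by linarith)]; ring_nf

theorem lowerKernel_eq (h1 : ν < 1) (hΔx : 0 < Δx) (k : ℕ) :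
    9 / 2 * lowerKernel ν Δx k = Δx ^ (-ν) * ((1 / Real.Gamma (3 - ν)) *
      ((2 - ν) / 2 * (((k : ℝ) + 1) ^ (1 - ν) - (k : ℝ) ^ (1 - ν)))) := by
  have hG : 0 < Real.Gamma (2 - ν) := Real.Gamma_pos_of_pos (by linarith)
  have h2 : 0 < 2 - ν := by linarith
  have hd : 0 < Δx ^ ν := rpow_pos_of_pos hΔx _
  rw [lowerKernel, gamma_three_sub h1, rpow_neg hΔx.le]
  field_simp

theorem lowerKernel_pos (h1 : ν < 1) (hΔx : 0 < Δx) (k : ℕ) : 0 < lowerKernel ν Δx k := by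
  have hG : 0 < Real.Gamma (2 - ν) := Real.Gamma_pos_of_pos (by linarith)
  have hd : 0 < Δx ^ ν := rpow_pos_of_pos hΔx _
  have : (k : ℝ) ^ (1 - ν) < ((k : ℝ) + 1) ^ (1 - ν) :=
    rpow_lt_rpow (by positivity) (by linarith) (by linarith)
  exact div_pos (by linarith) (by positivity)

theorem lowerKernel_le_succ (h0 : 0 < ν) (h1 : ν < 1) (hΔx : 0 < Δx) {k : ℕ} (hk : 1 ≤ k) :
    lowerKernel ν Δx k ≤ 3 * lowerKernel ν Δx (k + 1) := by
  have hG : 0 < Real.Gamma (2 - ν) := Real.Gamma_pos_of_pos (by linarith)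
  have hd : 0 < Δx ^ ν := rpow_pos_of_pos hΔx _
  have hk' : (1 : ℝ) ≤ k := by exact_mod_cast hk
  have hk0 : (0 : ℝ) < k := by linarith
  have hup := rpow_le_tangent (x := k) (y := k + 1) (a := 1 - ν) hk0 (by linarith)
    (by linarith) (by linarith)
  have hlo := rpow_le_tangent (x := (k : ℝ) + 1 + 1) (y := k + 1) (a := 1 - ν) (by linarith)
    (by linarith) (by linarith) (by linarith)
  have hcmp : (k : ℝ) ^ (1 - ν - 1) ≤ 3 * ((k : ℝ) + 1 + 1) ^ (1 - ν - 1) := by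
    have h3 : (3 : ℝ) ^ (-1 : ℝ) ≤ 3 ^ (1 - ν - 1) :=
      rpow_le_rpow_of_exponent_le (by norm_num) (by linarith)
    rw [rpow_neg_one] at h3
    have hm : (3 * (k : ℝ)) ^ (1 - ν - 1) ≤ ((k : ℝ) + 1 + 1) ^ (1 - ν - 1) :=
      rpow_le_rpow_of_nonpos (by linarith) (by linarith) (by linarith)
    rw [mul_rpow (by norm_num) hk0.le] at hm
    have := mul_le_mul_of_nonneg_right h3 (rpow_pos_of_pos hk0 (1 - ν - 1)).le
    linarith
  have := mul_le_mul_of_nonneg_left hcmp (by linarith : 0 ≤ 1 - ν)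
  rw [lowerKernel, lowerKernel, ← mul_div_assoc]
  push_cast
  gcongr
  linarith

theorem le_rightWeight (h0 : 0 < ν) (h1 : ν < 1) {x : ℝ} (hx : 0 ≤ x) :
    (1 / Real.Gamma (3 - ν)) * ((2 - ν) / 2 * ((x + 1) ^ (1 - ν) - x ^ (1 - ν)))
      ≤ rightWeight ν x := by
  have hG := gamma_three_sub_pos h1
  have a := trapezoid_le h0 h1 hx one_pos
  have b := trapezoid_le h0 h1 (t := x + 1) (by linarith) one_pos
  rw [show x + 1 + 1 = x + 2 by ring] at b
  have c : x ^ (1 - ν) ≤ (x + 1) ^ (1 - ν) := rpow_le_rpow hx (by linarith) (by linarith)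
  have := mul_le_mul_of_nonneg_left c (by linarith : 0 ≤ 2 - ν)
  refine mul_le_mul_of_nonneg_left ?_ (by positivity)
  linarith

theorem lowerKernel_le_diffCoeff (h0 : 0 < ν) (h1 : ν < 1) (hΔx : 0 < Δx) (hn : 3 ≤ n) {q : ℕ}
    (hq : 2 * q + 1 ≤ n) : 9 / 2 * lowerKernel ν Δx (2 * q) ≤ diffCoeff ν Δx n (2 * q) := by
  have hG := gamma_three_sub_pos h1
  have hd : 0 < Δx ^ (-ν) := rpow_pos_of_pos hΔx _
  rw [lowerKernel_eq h1 hΔx]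
  by_cases hodd : n % 2 = 1 → 3 ≤ n - 2 * q
  · rw [diffCoeff_even h0 h1 hn hq hodd]
    have := le_rightWeight h0 h1 (x := 2 * q) (by positivity)
    push_cast
    exact mul_le_mul_of_nonneg_left this hd.le
  · obtain rfl : n = 2 * q + 1 := by omega
    have hq0 : (0 : ℝ) < 2 * q := by
      have : (1 : ℝ) ≤ q := by exact_mod_cast (by omega : 1 ≤ q)
      linarith
    rw [diffCoeff_last h0 h1 (by omega)]
    have := tangent_le_rpow (x := 2 * (q : ℝ) + 1) (y := 2 * q) (a := 2 - ν) (by linarith)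
      hq0.le (by linarith)
    rw [show 2 - ν - 1 = 1 - ν by ring] at this
    push_cast
    refine mul_le_mul_of_nonneg_left (mul_le_mul_of_nonneg_left ?_ (by positivity)) hd.le
    linarith

theorem lowerKernel_le_Bbar_even (h0 : 0 < ν) (h1 : ν < 1) (hΔx : 0 < Δx) (hn : 3 ≤ n) {q : ℕ}
    (hq : 2 * q + 1 ≤ n) : 9 / 2 * lowerKernel ν Δx (2 * q) ≤ Bbar ν Δx n (2 * q) := by
  have hle := lowerKernel_le_diffCoeff h0 h1 hΔx hn hq
  cases q with
  | zero => exact hle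
  | succ q =>
    rw [show 2 * (q + 1) = 2 * q + 1 + 1 by ring] at hle ⊢
    have hlt := Bbar_succ_lt h0 h1 hΔx hn (i := 2 * q + 1) (by omega)
    have hpos := lowerKernel_pos h1 hΔx (ν := ν) (2 * q + 1 + 1)
    have hθ := theta_pos h0
    have hθ1 := theta_lt_one h0 h1
    rw [diffCoeff] at hle
    have hB : 0 < Bbar ν Δx n (2 * q + 1) := by
      by_contra! h
      nlinarith
    nlinarith [mul_pos hθ hB]

theorem lowerKernel_le_Bbar_odd (h0 : 0 < ν) (h1 : ν < 1) (hΔx : 0 < Δx) (hn : 3 ≤ n) {q : ℕ}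
    (hq : 2 * q + 3 ≤ n) : lowerKernel ν Δx (2 * q + 1) ≤ Bbar ν Δx n (2 * q + 1) := by
  have hlt := Bbar_succ_lt h0 h1 hΔx hn (i := 2 * q + 1) (by omega)
  have hev := lowerKernel_le_Bbar_even h0 h1 hΔx hn (q := q + 1) (by omega)
  have hk := lowerKernel_le_succ h0 h1 hΔx (k := 2 * q + 1) (by omega)
  have hpos := lowerKernel_pos h1 hΔx (ν := ν) (2 * q + 1 + 1)
  rw [show 2 * (q + 1) = 2 * q + 1 + 1 by ring] at hev
  linarith

theorem dco_add_two {k : ℕ} (heven : n % 2 = 0) (hk : 1 ≤ k) (hkn : k + 1 ≤ n) :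
    dco ν (n + 2) (k + 2) = dco ν n k := by
  obtain ⟨q, hq | hq⟩ : ∃ q, n = k + 2 * q + 1 ∨ n = k + 2 * q + 2 := ⟨(n - k - 1) / 2, by omega⟩
  · rw [dco_mid (q := q) hk hq (by omega), dco_mid (q := q) (by omega) (by omega) (by omega)]
  · rw [dco_node (q := q) hk hq (by omega), dco_node (q := q) (by omega) (by omega) (by omega)]

theorem diffCoeff_add_two (h0 : 0 < ν) (h1 : ν < 1) (hn : 3 ≤ n) (heven : n % 2 = 0) {i : ℕ}
    (hi : i + 1 ≤ n) : diffCoeff ν Δx (n + 2) i = diffCoeff ν Δx n i := by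
  induction i with
  | zero => rfl
  | succ i ih =>
    rw [diffCoeff_succ h0 h1 (by omega) (by omega), diffCoeff_succ h0 h1 hn (by omega),
      ih (by omega), show n + 2 - (i + 1) = n - (i + 1) + 2 by omega,
      dco_add_two heven (by omega) (by omega)]

/-- For even `n` the kernel does not depend on `n`. -/
theorem Bbar_add_two (h0 : 0 < ν) (h1 : ν < 1) (hn : 3 ≤ n) (heven : n % 2 = 0) {i : ℕ}
    (hi : i + 1 ≤ n) : Bbar ν Δx (n + 2) i = Bbar ν Δx n i := by
  induction i with
  | zero => rfl
  | succ i ih =>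
    have h := diffCoeff_add_two (Δx := Δx) h0 h1 hn heven hi
    rw [diffCoeff, diffCoeff, ih (by omega)] at h
    linarith

theorem lowerKernel_le_Bbar (h0 : 0 < ν) (h1 : ν < 1) (hΔx : 0 < Δx) (hn : 3 ≤ n) {k : ℕ}
    (hk : k ≤ n - 1) : lowerKernel ν Δx k ≤ Bbar ν Δx n k := by
  rcases Nat.even_or_odd' k with ⟨q, rfl | rfl⟩
  · have := lowerKernel_le_Bbar_even h0 h1 hΔx hn (q := q) (by omega)
    have := lowerKernel_pos h1 hΔx (ν := ν) (2 * q)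
    linarith
  · by_cases hq : 2 * q + 3 ≤ n
    · exact lowerKernel_le_Bbar_odd h0 h1 hΔx hn hq
    · rw [← Bbar_add_two h0 h1 hn (by omega) (by omega)]
      exact lowerKernel_le_Bbar_odd h0 h1 hΔx (by omega) (by omega)

end Kernel

theorem stmt10 (ν Δx : ℝ) (hν : ν ∈ Set.Ioo (0:ℝ) 1) (hΔx : 0 < Δx) (n : ℕ) (hn : 3 ≤ n) :
    (∀ i : ℕ, i + 1 ≤ n - 1 → Bbar ν Δx n (i + 1) < Bbar ν Δx n i) ∧
    0 < Bbar ν Δx n (n - 1) ∧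
    (∀ k : ℕ, k ≤ n - 1 →
      (((k : ℝ) + 1) ^ (1 - ν) - (k : ℝ) ^ (1 - ν)) / (9 * Δx ^ ν * Real.Gamma (2 - ν))
        ≤ Bbar ν Δx n k) :=
  ⟨fun _ hi => Bbar_succ_lt hν.1 hν.2 hΔx hn hi,
    (lowerKernel_pos hν.2 hΔx (n - 1)).trans_le (lowerKernel_le_Bbar hν.1 hν.2 hΔx hn le_rfl),
    fun _ hk => lowerKernel_le_Bbar hν.1 hν.2 hΔx hn hk⟩
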